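/- arXiv:2102.01543 — 3 statements merged into one kernel-verified Lean document; each statement's English description precedes it below -/
import Mathlib

section
/- Let m ≥ 1 and Q ≥ 1 be reals and let L ≥ 64. Let S ⊆ [−2mQ, 2mQ] be a measurable subset of ℝ such that the difference set S − S = {x − y : x, y ∈ S} contains no element of the interval [2L^{−2/3}, ½L^{−1/3}]. Then the Lebesgue measure of S is at most 40·mQ·L^{−1/3}. -/
open MeasureTheory

theorem statement17 (m Q L : ℝ) (hm : 1 ≤ m) (hQ : 1 ≤ Q) (hL : 64 ≤ L)
    (S : Set ℝ) (hS : MeasurableSet S) (hsub : S ⊆ Set.Icc (-(2 * m * Q)) (2 * m * Q))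
    (hdiff : ∀ x ∈ S, ∀ y ∈ S,
      x - y ∉ Set.Icc (2 * L ^ (-(2 : ℝ) / 3)) ((1 / 2) * L ^ (-(1 : ℝ) / 3))) :
    volume S ≤ ENNReal.ofReal (40 * m * Q * L ^ (-(1 : ℝ) / 3)) := by
  have hL0 : 0 < L := by linarith
  have h2 : L ^ (-(2 : ℝ) / 3) = (L ^ (-(1 : ℝ) / 3)) ^ 2 := by
    rw [← Real.rpow_natCast, ← Real.rpow_mul hL0.le]; norm_num
  have ht0 : 0 < L ^ (-(1 : ℝ) / 3) := Real.rpow_pos_of_pos hL0 _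
  have ht1 : L ^ (-(1 : ℝ) / 3) ≤ 1 / 4 := by
    calc L ^ (-(1 : ℝ) / 3) ≤ (64 : ℝ) ^ (-(1 : ℝ) / 3) :=
          Real.rpow_le_rpow_of_nonpos (by norm_num) hL (by norm_num)
      _ = 1 / 4 := by
          rw [show (64 : ℝ) = (4 : ℝ) ^ (3 : ℝ) by norm_num, ← Real.rpow_mul (by norm_num)]
          norm_num [Real.rpow_neg_one]
  rw [h2] at hdiff
  generalize L ^ (-(1 : ℝ) / 3) = t at *
  have hmQ : 1 ≤ m * Q := by nlinarith
  have key : ∀ c : ℝ, volume (S ∩ Set.Icc c (c + 1 / 2 * t)) ≤ ENNReal.ofReal (2 * t ^ 2) := by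
    intro c
    have aux : ∀ x ∈ S ∩ Set.Icc c (c + 1 / 2 * t), ∀ y ∈ S ∩ Set.Icc c (c + 1 / 2 * t),
        x - y ≤ 2 * t ^ 2 := by
      rintro x ⟨hx, hx1, hx2⟩ y ⟨hy, hy1, hy2⟩
      by_contra! h
      exact hdiff x hx y hy ⟨h.le, by linarith⟩
    refine (Real.volume_le_diam _).trans (Metric.ediam_le fun x hx y hy => ?_)
    rw [edist_dist]
    apply ENNReal.ofReal_le_ofReal
    rw [Real.dist_eq, abs_le]
    constructor <;> linarith [aux x hx y hy, aux y hy x hx]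
  set N : ℕ := ⌊8 * (m * Q) / t⌋₊ with hN
  have hcov : S ⊆ ⋃ k ∈ Finset.range (N + 1),
      (S ∩ Set.Icc (-(2 * m * Q) + k * (1 / 2 * t)) (-(2 * m * Q) + k * (1 / 2 * t) + 1 / 2 * t)) := by
    intro x hx
    obtain ⟨h1, h3⟩ := hsub hx
    have hb : 0 < 1 / 2 * t := by linarith
    have hnn : 0 ≤ (x + 2 * m * Q) / (1 / 2 * t) := div_nonneg (by linarith) hb.le
    simp only [Set.mem_iUnion, Finset.mem_range]
    refine ⟨⌊(x + 2 * m * Q) / (1 / 2 * t)⌋₊, ?_, hx, ?_, ?_⟩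
    · rw [Nat.lt_succ_iff]
      apply Nat.floor_mono
      rw [div_le_div_iff₀ hb ht0]
      nlinarith
    · have := Nat.floor_le hnn
      rw [le_div_iff₀ hb] at this
      linarith
    · have := Nat.lt_floor_add_one ((x + 2 * m * Q) / (1 / 2 * t))
      rw [div_lt_iff₀ hb] at this
      linarith
  have hNle : (N : ℝ) * t ≤ 8 * (m * Q) := by
    rw [← le_div_iff₀ ht0]
    exact Nat.floor_le (by positivity)
  calc volume S ≤ _ := measure_mono hcov
    _ ≤ _ := measure_biUnion_finset_le _ _
    _ ≤ ∑ k ∈ Finset.range (N + 1), ENNReal.ofReal (2 * t ^ 2) :=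
        Finset.sum_le_sum fun k _ => key _
    _ = ENNReal.ofReal ((N + 1 : ℕ) * (2 * t ^ 2)) := by
        rw [Finset.sum_const, Finset.card_range, nsmul_eq_mul,
          ENNReal.ofReal_mul (p := ((N + 1 : ℕ) : ℝ)) (by positivity), ENNReal.ofReal_natCast]
    _ ≤ _ := by
        apply ENNReal.ofReal_le_ofReal
        push_cast
        have h5 := mul_le_mul_of_nonneg_right hNle ht0.le
        have h6 := mul_le_mul_of_nonneg_right hmQ ht0.le
        have h7 := mul_le_mul_of_nonneg_right ht1 ht0.le
        nlinarith
end

section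
/- Let m ≥ 1 be an integer and let s be an integer with s ≥ 16m². Then there exist an integer k ≥ s/16 and subsets I₁,…,I_k ⊆ {1,…,s}, each of cardinality exactly m, such that the sets of unordered pairs {{i, j} : i, j ∈ I_ℓ, i ≠ j} are pairwise disjoint as ℓ ranges over 1,…,k. -/
theorem aux_prime (m s : ℕ) (hm : 1 ≤ m) (hs : 16 * m ^ 2 ≤ s) :
    ∃ p : ℕ, p.Prime ∧ m ≤ p ∧ m * p ≤ s ∧ s ≤ 16 * (p * p) := by
  have h1 : 4 * m ≤ Nat.sqrt s := by
    rw [Nat.le_sqrt]; nlinarith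
  have h2 := Nat.sqrt_le s
  have h3 := Nat.lt_succ_sqrt s
  generalize Nat.sqrt s = q at *
  obtain ⟨p, hp, hl, hu⟩ := Nat.exists_prime_lt_and_le_two_mul (q / 4 + 1) (by omega)
  refine ⟨p, hp, by omega, ?_, ?_⟩
  · have : m ≤ q := by omega
    have h5 : p ≤ q := by omega
    exact (Nat.mul_le_mul this h5).trans h2
  · have h6 : q.succ ≤ 4 * p := by omega
    have := Nat.mul_le_mul h6 h6
    nlinarith

theorem statement18 (m s : ℕ) (hm : 1 ≤ m) (hs : 16 * m ^ 2 ≤ s) :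
    ∃ k : ℕ, (s : ℝ) / 16 ≤ (k : ℝ) ∧
    ∃ I : Fin k → Finset (Fin s),
      (∀ ℓ, (I ℓ).card = m) ∧
      (∀ ℓ ℓ' : Fin k, ℓ ≠ ℓ' → ∀ i j : Fin s, i ≠ j →
        i ∈ I ℓ → j ∈ I ℓ → ¬(i ∈ I ℓ' ∧ j ∈ I ℓ')) := by
  obtain ⟨p, hp, hmp, hps, hsp⟩ := aux_prime m s hm hs
  have : Fact p.Prime := ⟨hp⟩
  have hlt : ∀ (x : Fin m) (z : ZMod p), x.val * p + z.val < s := by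
    intro x z
    have h1 := ZMod.val_lt z
    have h2 : (x.val + 1) * p ≤ m * p := Nat.mul_le_mul_right _ x.2
    nlinarith
  let F : Fin m → ZMod p → Fin s := fun x z => ⟨x.val * p + z.val, hlt x z⟩
  have hF : ∀ x z x' z', F x z = F x' z' → x = x' ∧ z = z' := by
    intro x z x' z' h
    have h0 : x.val * p + z.val = x'.val * p + z'.val := congrArg Fin.val h
    have h1 := ZMod.val_lt z
    have h2 := ZMod.val_lt z'
    have hx : x.val = x'.val := by
      have := congrArg (· / p) h0
      simpa [Nat.add_div_of_dvd_right, Nat.mul_div_cancel _ hp.pos,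
        Nat.div_eq_of_lt h1, Nat.div_eq_of_lt h2] using this
    refine ⟨Fin.ext hx, ZMod.val_injective p ?_⟩
    rw [hx] at h0
    omega
  have hc : Fintype.card (ZMod p × ZMod p) = p * p := by simp [ZMod.card]
  let e : Fin (p * p) ≃ ZMod p × ZMod p := (Fintype.equivFinOfCardEq hc).symm
  refine ⟨p * p, ?_, fun l => Finset.univ.image
    (fun x : Fin m => F x ((e l).1 + (e l).2 * (x.val : ZMod p))), ?_, ?_⟩
  · have : (s : ℝ) ≤ 16 * ((p * p : ℕ) : ℝ) := by exact_mod_cast hsp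
    linarith
  · intro l
    rw [Finset.card_image_of_injective _ (fun x y h => (hF _ _ _ _ h).1)]
    simp
  · intro l l' hne i j hij hi hj ⟨hi', hj'⟩
    simp only [Finset.mem_image, Finset.mem_univ, true_and] at hi hj hi' hj'
    obtain ⟨x, rfl⟩ := hi
    obtain ⟨y, rfl⟩ := hj
    obtain ⟨x', hx⟩ := hi'
    obtain ⟨y', hy⟩ := hj'
    obtain ⟨rfl, hx⟩ := hF _ _ _ _ hx
    obtain ⟨rfl, hy⟩ := hF _ _ _ _ hy
    have hxy : (x'.val : ZMod p) - (y'.val : ZMod p) ≠ 0 := by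
      intro h
      have h := sub_eq_zero.1 h
      rw [ZMod.natCast_eq_natCast_iff'] at h
      rw [Nat.mod_eq_of_lt (by omega), Nat.mod_eq_of_lt (by omega)] at h
      exact hij (by rw [Fin.ext h])
    have h2 : (e l').2 = (e l).2 := by
      apply mul_right_cancel₀ hxy
      linear_combination hx - hy
    have h1 : (e l').1 = (e l).1 := by
      rw [h2] at hx
      exact add_right_cancel hx
    exact hne (e.injective (Prod.ext h1.symm h2.symm))
end

section
/- Let Q ≥ 1 be a real parameter, let n be a sufficiently large integer, let 1 ≤ m ≤ n, and let V ≤ ℝ^n be a vector subspace of dimension m. Then #{x ∈ ℤ^n : max_i |x_i| ≤ Q and x ∈ V} ≤ 20^n · m^{n/2} · Q^m, uniformly in V. -/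
theorem coord_select {n : ℕ} (V : Submodule ℝ (Fin n → ℝ)) :
    ∃ d : ℕ, d ≤ Module.finrank ℝ V ∧ ∃ g : Fin d → Fin n,
      ∀ x ∈ V, (∀ j, x (g j) = 0) → x = 0 := by
  let φ : Fin n → Module.Dual ℝ V := fun i => (LinearMap.proj i).comp V.subtype
  obtain ⟨f, hf, hs, -⟩ := Submodule.exists_fun_fin_finrank_span_eq ℝ (Set.range φ)
  choose g hg using hf
  refine ⟨_, ?_, g, ?_⟩
  · exact (Submodule.finrank_le _).trans Subspace.dual_finrank_eq.le
  · intro x hx h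
    have key : ∀ ψ ∈ Submodule.span ℝ (Set.range f), ψ ⟨x, hx⟩ = 0 := by
      intro ψ hψ
      induction hψ using Submodule.span_induction with
      | mem a ha =>
        obtain ⟨j, rfl⟩ := ha
        rw [← hg j]
        exact h j
      | zero => rfl
      | add a b _ _ ha hb => simp [ha, hb]
      | smul c a _ ha => simp [ha]
    rw [hs] at key
    funext i
    exact key (φ i) (Submodule.subset_span ⟨i, rfl⟩)

theorem statement19 :
    ∃ n₀ : ℕ, ∀ n : ℕ, n₀ ≤ n → ∀ Q : ℝ, 1 ≤ Q → ∀ m : ℕ, 1 ≤ m → m ≤ n →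
    ∀ V : Submodule ℝ (Fin n → ℝ), Module.finrank ℝ V = m →
    ((Nat.card {x : Fin n → ℤ | (∀ i, (|x i| : ℝ) ≤ Q) ∧ (fun i => (x i : ℝ)) ∈ V}) : ℝ)
      ≤ 20 ^ n * (m : ℝ) ^ ((n : ℝ) / 2) * Q ^ m := by
  refine ⟨0, fun n _ Q hQ m hm hmn V hV => ?_⟩
  obtain ⟨d, hd, g, hg⟩ := coord_select V
  rw [hV] at hd
  have hb : ∀ z : ℤ, |(z : ℝ)| ≤ Q → z ∈ Finset.Icc (-⌊Q⌋) ⌊Q⌋ := by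
    intro z hz
    rw [abs_le] at hz
    rw [Finset.mem_Icc]
    have h1 : -z ≤ ⌊Q⌋ := Int.le_floor.2 (by push_cast; linarith)
    exact ⟨by linarith, Int.le_floor.2 hz.2⟩
  let F : {x : Fin n → ℤ | (∀ i, (|x i| : ℝ) ≤ Q) ∧ (fun i => (x i : ℝ)) ∈ V} →
      (Fin d → Finset.Icc (-⌊Q⌋) ⌊Q⌋) := fun x j => ⟨x.1 (g j), hb _ (x.2.1 (g j))⟩
  have hF : Function.Injective F := by
    intro x y hxy
    apply Subtype.ext
    have := hg _ (V.sub_mem x.2.2 y.2.2) (by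
      intro j
      have h := congrArg Subtype.val (congrFun hxy j)
      have h' : x.1 (g j) = y.1 (g j) := h
      simp [h'])
    funext i
    have h := congrFun this i
    simp only [Pi.sub_apply, Pi.zero_apply] at h
    exact_mod_cast sub_eq_zero.1 h
  have hc := Nat.card_le_card_of_injective F hF
  rw [Nat.card_eq_fintype_card (α := Fin d → _), Fintype.card_fun, Fintype.card_coe,
    Int.card_Icc, Fintype.card_fin] at hc
  have hQ0 : (1 : ℤ) ≤ ⌊Q⌋ := Int.le_floor.2 (by simpa using hQ)
  have hcard : (((⌊Q⌋ + 1 - -⌊Q⌋).toNat : ℕ) : ℝ) ≤ 3 * Q := by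
    have h1 : (((⌊Q⌋ + 1 - -⌊Q⌋).toNat : ℕ) : ℤ) = 2 * ⌊Q⌋ + 1 := by omega
    have h2 : (((⌊Q⌋ + 1 - -⌊Q⌋).toNat : ℕ) : ℝ) = 2 * (⌊Q⌋ : ℝ) + 1 := by exact_mod_cast h1
    have h3 := Int.floor_le Q
    linarith
  have hm1 : (1 : ℝ) ≤ (m : ℝ) ^ ((n : ℝ) / 2) :=
    Real.one_le_rpow (by exact_mod_cast hm) (by positivity)
  calc _ ≤ (((⌊Q⌋ + 1 - -⌊Q⌋).toNat : ℕ) : ℝ) ^ d := by exact_mod_cast hc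
    _ ≤ (3 * Q) ^ d := by gcongr
    _ ≤ (3 * Q) ^ m := pow_le_pow_right₀ (by linarith) hd
    _ = 3 ^ m * 1 * Q ^ m := by rw [mul_pow, mul_one]
    _ ≤ 20 ^ n * (m : ℝ) ^ ((n : ℝ) / 2) * Q ^ m := by
      have : (3 : ℝ) ^ m ≤ 20 ^ n :=
        (pow_le_pow_right₀ (by norm_num) hmn).trans (by gcongr; norm_num)
      gcongr
end
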